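/- Let k ≥ 1 be an integer. Let λ₁, λ₂, λ₃ : ℝ³ → ℝ be nonconstant affine functions whose zero sets are pairwise distinct planes, and let E ⊂ ℝ³ be a nonempty bounded open set such that λ₁(x)·λ₂(x)·λ₃(x) ≥ 0 for all x ∈ E. Let p be a real polynomial in three variables of total degree at most k. If (i) p vanishes at every point of each of the three planes {λ_i = 0}, i = 1, 2, 3, and (ii) ∫_E p(x) q(x) dx = 0 for every real polynomial q in three variables of total degree at most k−3, then p is the zero polynomial. -/

import Mathlib

open MeasureTheory

namespace MvPolynomial

variable {σ K : Type*} [Field K]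

lemma totalDegree_pos_of_prime {p : MvPolynomial σ K} (hp : Prime p) : 0 < p.totalDegree := by
  refine Nat.pos_of_ne_zero fun h => ?_
  rw [totalDegree_eq_zero_iff_eq_C] at h
  refine hp.not_isUnit ?_
  rw [h]
  refine IsUnit.map C (isUnit_iff_ne_zero.2 fun h₀ => hp.ne_zero ?_)
  rw [h, h₀, C_0]

variable [Fintype σ]

/-- The affine polynomial `∑ l, a l * X l + c`. -/
noncomputable def affineForm (a : σ → K) (c : K) : MvPolynomial σ K :=
  ∑ l, C (a l) * X l + C c

@[simp]
lemma eval_affineForm (a : σ → K) (c : K) (x : σ → K) :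
    eval x (affineForm a c) = ∑ l, a l * x l + c := by
  simp [affineForm]

/-- The substitution projecting onto the zero set of an affine form along the `j`-th axis. -/
noncomputable def affineProj [DecidableEq σ] (a : σ → K) (c : K) (j : σ) :
    MvPolynomial σ K →ₐ[K] MvPolynomial σ K :=
  aeval fun l => X l - C ((Pi.single j (a j)⁻¹ : σ → K) l) * affineForm a c

lemma affineForm_dvd_sub_affineProj [DecidableEq σ] (a : σ → K) (c : K) (j : σ)
    (p : MvPolynomial σ K) : affineForm a c ∣ p - affineProj a c j p := by
  rw [← Ideal.mem_span_singleton, ← Ideal.Quotient.eq]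
  have : (Ideal.Quotient.mkₐ K (Ideal.span {affineForm a c})) =
      (Ideal.Quotient.mkₐ K (Ideal.span {affineForm a c})).comp (affineProj a c j) := by
    ext l
    simp only [AlgHom.comp_apply, affineProj, aeval_X, Ideal.Quotient.mkₐ_eq_mk]
    rw [Ideal.Quotient.eq, sub_sub_cancel]
    exact Ideal.mul_mem_left _ _ (Ideal.mem_span_singleton_self _)
  exact DFunLike.congr_fun this p

lemma affineProj_affineForm [DecidableEq σ] {a : σ → K} (c : K) {j : σ} (hj : a j ≠ 0) :
    affineProj a c j (affineForm a c) = 0 := by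
  have h : ∑ l, C (a l) * (C ((Pi.single j (a j)⁻¹ : σ → K) l) * affineForm a c) =
      affineForm a c := by
    rw [Finset.sum_eq_single j]
    · rw [← mul_assoc, ← C_mul]; simp [hj]
    · intro l _ hl; simp [hl]
    · simp
  conv_lhs => enter [2]; rw [affineForm]
  simp only [map_add, map_sum, map_mul, affineProj, aeval_X, aeval_C, algebraMap_eq, mul_sub,
    Finset.sum_sub_distrib, h]
  rw [sub_add_eq_add_sub, ← affineForm, sub_self]

lemma affineForm_dvd_iff [DecidableEq σ] {a : σ → K} {c : K} {j : σ} (hj : a j ≠ 0)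
    {p : MvPolynomial σ K} : affineForm a c ∣ p ↔ affineProj a c j p = 0 := by
  refine ⟨?_, fun h => by simpa [h] using affineForm_dvd_sub_affineProj a c j p⟩
  rintro ⟨q, rfl⟩
  rw [map_mul, affineProj_affineForm c hj, zero_mul]

lemma affineForm_ne_zero {a : σ → K} (c : K) (ha : a ≠ 0) : affineForm a c ≠ 0 := by
  classical
  obtain ⟨j, hj⟩ := Function.ne_iff.1 ha
  intro h
  have h₀ : c = 0 := by simpa [affineForm] using congrArg (eval 0) h
  refine hj ?_
  simpa [h₀, Pi.single_apply] using congrArg (eval (Pi.single j 1)) h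

lemma prime_affineForm {a : σ → K} (c : K) (ha : a ≠ 0) : Prime (affineForm a c) := by
  classical
  obtain ⟨j, hj⟩ := Function.ne_iff.1 ha
  refine ⟨affineForm_ne_zero c ha, fun h => ?_, fun p q h => ?_⟩
  · have h₁ := (affineForm_dvd_iff hj).1 (h.dvd (a := (1 : MvPolynomial σ K)))
    simp at h₁
  · simpa only [affineForm_dvd_iff hj, map_mul, mul_eq_zero] using h

/-- A polynomial vanishing on an affine hyperplane is divisible by its equation. -/
lemma affineForm_dvd_of_eval_eq_zero [Infinite K] {a : σ → K} {c : K} (ha : a ≠ 0)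
    {p : MvPolynomial σ K} (h : ∀ x : σ → K, ∑ l, a l * x l + c = 0 → eval x p = 0) :
    affineForm a c ∣ p := by
  classical
  obtain ⟨j, hj⟩ := Function.ne_iff.1 ha
  rw [affineForm_dvd_iff hj]
  have key (x : σ → K) (q : MvPolynomial σ K) : eval x (affineProj a c j q) =
      eval (fun l => eval x (affineProj a c j (X l))) q := by
    have : (aeval x).comp (affineProj a c j) =
        aeval (R := K) (fun l => eval x (affineProj a c j (X l))) := by
      ext l; simp [aeval_eq_eval]
    simpa [aeval_eq_eval] using DFunLike.congr_fun this q
  refine funext fun x => ?_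
  rw [key, map_zero]
  refine h _ ?_
  rw [← eval_affineForm, ← key, affineProj_affineForm c hj, map_zero]

/-- A real polynomial vanishing on a nonempty open set is zero. -/
lemma eq_zero_of_eqOn_isOpen {p : MvPolynomial σ ℝ} {U : Set (σ → ℝ)}
    (hU : IsOpen U) (hne : U.Nonempty) (h : ∀ x ∈ U, eval x p = 0) : p = 0 := by
  obtain ⟨x, hx⟩ := hne
  obtain ⟨ε, hε, hball⟩ := Metric.isOpen_iff.1 hU x hx
  refine funext_set (fun i => Metric.ball (x i) ε) (fun i => ?_) fun y hy => ?_
  · rw [Real.ball_eq_Ioo]; exact Set.Ioo_infinite (by linarith)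
  · rw [map_zero]
    exact h y (hball (by rwa [ball_pi x hε]))

end MvPolynomial

open MvPolynomial

/-- Three-dimensional unisolvence for a tetrahedron-like virtual element: a polynomial
of total degree ≤ k vanishing on three pairwise distinct planes, on an element where
the product of the three affine face equations does not change sign, and whose internal
moments against all polynomials of degree ≤ k−3 vanish, is the zero polynomial. -/
theorem tetrahedron_like_unisolvence
    (k : ℕ) (hk : 1 ≤ k)
    (a : Fin 3 → Fin 3 → ℝ) (c : Fin 3 → ℝ) (ha : ∀ i, a i ≠ 0)
    (hdist : ∀ i j : Fin 3, i ≠ j →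
      {x : Fin 3 → ℝ | (∑ l, a i l * x l) + c i = 0} ≠
      {x : Fin 3 → ℝ | (∑ l, a j l * x l) + c j = 0})
    (E : Set (Fin 3 → ℝ)) (hEopen : IsOpen E) (hEne : E.Nonempty)
    (hEbdd : Bornology.IsBounded E)
    (hsign : ∀ x ∈ E, 0 ≤ ∏ i : Fin 3, ((∑ l, a i l * x l) + c i))
    (p : MvPolynomial (Fin 3) ℝ) (hp : p.totalDegree ≤ k)
    (hvan : ∀ i : Fin 3, ∀ x : Fin 3 → ℝ, (∑ l, a i l * x l) + c i = 0 →
      MvPolynomial.eval x p = 0)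
    (hmom : ∀ q : MvPolynomial (Fin 3) ℝ, (q.totalDegree : ℤ) ≤ (k : ℤ) - 3 →
      ∫ x in E, MvPolynomial.eval x p * MvPolynomial.eval x q = 0) :
    p = 0 := by
  have hprime i : Prime (affineForm (a i) (c i)) := prime_affineForm (c i) (ha i)
  have hdvd : ∏ i, affineForm (a i) (c i) ∣ p := by
    refine Finset.prod_dvd_of_isRelPrime (fun i _ j _ hij => ?_)
      fun i _ => affineForm_dvd_of_eval_eq_zero (ha i) (hvan i)
    refine (hprime i).irreducible.isRelPrime_iff_not_dvd.2 fun h => hdist i j hij ?_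
    obtain ⟨u, hu⟩ := (hprime i).associated_of_dvd (hprime j) h
    ext x
    have hux : eval x (u : MvPolynomial (Fin 3) ℝ) ≠ 0 := (u.isUnit.map (eval x)).ne_zero
    simp only [Set.mem_ofPred_eq, ← eval_affineForm, ← hu, map_mul, mul_eq_zero, hux, or_false]
  obtain ⟨q, rfl⟩ := hdvd
  by_contra hne
  have hq : q ≠ 0 := right_ne_zero_of_mul hne
  have hdeg : q.totalDegree + 3 ≤ k := by
    have h i := totalDegree_pos_of_prime (hprime i)
    simp only [Fin.prod_univ_three] at hp
    rw [totalDegree_mul_of_isDomain (mul_ne_zero (mul_ne_zero (hprime 0).ne_zero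
      (hprime 1).ne_zero) (hprime 2).ne_zero) hq, totalDegree_mul_of_isDomain (mul_ne_zero
      (hprime 0).ne_zero (hprime 1).ne_zero) (hprime 2).ne_zero, totalDegree_mul_of_isDomain
      (hprime 0).ne_zero (hprime 1).ne_zero] at hp
    have := h 0
    have := h 1
    have := h 2
    omega
  set P := (∏ i, affineForm (a i) (c i)) * q with hP
  have hcont : Continuous fun x => eval x P * eval x q :=
    (continuous_eval P).mul (continuous_eval q)
  have hint : IntegrableOn (fun x => eval x P * eval x q) E :=
    (hcont.continuousOn.integrableOn_compact hEbdd.isCompact_closure).mono_set subset_closure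
  have hnonneg : ∀ x ∈ E, 0 ≤ eval x P * eval x q := fun x hx => by
    rw [hP, map_mul, mul_assoc]
    refine mul_nonneg ?_ (mul_self_nonneg _)
    simpa only [map_prod, eval_affineForm] using hsign x hx
  have hae := (setIntegral_eq_zero_iff_of_nonneg_ae
    ((ae_restrict_iff' hEopen.measurableSet).2 (.of_forall hnonneg)) hint).1
    (hmom q (by omega))
  have hzero := Measure.eqOn_open_of_ae_eq hae hEopen hcont.continuousOn continuousOn_const
  refine mul_ne_zero hne hq (eq_zero_of_eqOn_isOpen hEopen hEne fun x hx => ?_)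
  rw [map_mul]
  exact hzero hx
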